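/- A pair q = (q_1, q_2) of nondecreasing left-continuous functions q_i : [0,1] → [0,1] is rationalizable if and only if q_1 ⪯ q̂_2, i.e., q_1 is majorized by the conjugate of q_2. -/

import Mathlib

open MeasureTheory

noncomputable section

/-- The closed unit square `[0,1]²`. -/
def unitSq : Set (ℝ × ℝ) := Set.Icc 0 1

/-- `q : [0,1] → [0,1]` is nondecreasing and left-continuous. -/
def MonoLC (q : ℝ → ℝ) : Prop :=
  MonotoneOn q (Set.Icc 0 1) ∧
  (∀ t ∈ Set.Icc (0 : ℝ) 1, q t ∈ Set.Icc (0 : ℝ) 1) ∧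
  ∀ t ∈ Set.Ioc (0 : ℝ) 1, Filter.Tendsto q (nhdsWithin t (Set.Iio t)) (nhds (q t))

/-- `f : [0,1]² → [0,1]` rationalizes the pair `(q₁, q₂)`: the `qᵢ` are (a.e.) the
one-dimensional marginals of `f`. -/
def Rat2 (f : ℝ × ℝ → ℝ) (q₁ q₂ : ℝ → ℝ) : Prop :=
  AEMeasurable f (volume.restrict unitSq) ∧
  (∀ x ∈ unitSq, f x ∈ Set.Icc (0 : ℝ) 1) ∧
  (∀ᵐ t ∂(volume.restrict (Set.Icc (0 : ℝ) 1)),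
    q₁ t = ∫ y in Set.Icc (0 : ℝ) 1, f (t, y)) ∧
  (∀ᵐ t ∂(volume.restrict (Set.Icc (0 : ℝ) 1)),
    q₂ t = ∫ y in Set.Icc (0 : ℝ) 1, f (y, t))

/-- The set `𝒬` of rationalizable pairs of nondecreasing left-continuous functions. -/
def Q2 : Set ((ℝ → ℝ) × (ℝ → ℝ)) :=
  {q | MonoLC q.1 ∧ MonoLC q.2 ∧ ∃ f, Rat2 f q.1 q.2}

/-- `A` is an up-set of the square `[0,1]²`. -/
def UpSet2 (A : Set (ℝ × ℝ)) : Prop :=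
  A ⊆ unitSq ∧ ∀ x ∈ A, ∀ y ∈ unitSq, x ≤ y → y ∈ A

/-- `q` is an extreme point of a set `S` of pairs of functions on `[0,1]`, with
componentwise convex combinations (only the values on `[0,1]` matter). -/
def ExtremePt2 (S : Set ((ℝ → ℝ) × (ℝ → ℝ))) (q : (ℝ → ℝ) × (ℝ → ℝ)) : Prop :=
  q ∈ S ∧ ∀ q' ∈ S, ∀ q'' ∈ S, ∀ l : ℝ, 0 < l → l < 1 →
    (∀ t ∈ Set.Icc (0 : ℝ) 1,
      q.1 t = l * q'.1 t + (1 - l) * q''.1 t ∧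
      q.2 t = l * q'.2 t + (1 - l) * q''.2 t) →
    ∀ t ∈ Set.Icc (0 : ℝ) 1, q'.1 t = q''.1 t ∧ q'.2 t = q''.2 t

/-- Generalized inverse `g⁻¹(z) = inf { x ∈ [0,1] : g x > z }`, with `inf ∅ := 1`. -/
def ginv (g : ℝ → ℝ) (z : ℝ) : ℝ :=
  sInf (insert 1 {x | x ∈ Set.Icc (0 : ℝ) 1 ∧ z < g x})

/-- The conjugate `ĝ(z) = 1 − g⁻¹(1 − z)` of a nondecreasing left-continuous function. -/
def conj (g : ℝ → ℝ) (z : ℝ) : ℝ := 1 - ginv g (1 - z)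

/-- `g₂` majorizes `g₁`: `∫_x^1 g₁ ≤ ∫_x^1 g₂` for all `x ∈ [0,1]`, with equality at `x = 0`. -/
def Maj (g₁ g₂ : ℝ → ℝ) : Prop :=
  (∀ x ∈ Set.Icc (0 : ℝ) 1, (∫ z in x..1, g₁ z) ≤ ∫ z in x..1, g₂ z) ∧
  (∫ z in (0 : ℝ)..1, g₁ z) = ∫ z in (0 : ℝ)..1, g₂ z

theorem nonempty_iInter_of_antitone_of_convex {E : Type*} [NormedAddCommGroup E]
    [InnerProductSpace ℝ E] [CompleteSpace E] {C : ℕ → Set E} (hanti : Antitone C)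
    (hne : ∀ n, (C n).Nonempty) (hclosed : ∀ n, IsClosed (C n)) (hconv : ∀ n, Convex ℝ (C n))
    (hbdd : Bornology.IsBounded (C 0)) : (⋂ n, C n).Nonempty := by
  choose x hxC hx using fun n =>
    exists_norm_eq_iInf_of_complete_convex (hne n) (hclosed n).isComplete (hconv n) (0 : E)
  have hinner : ∀ n, ∀ w ∈ C n, ‖w - x n‖ ^ 2 ≤ ‖w‖ ^ 2 - ‖x n‖ ^ 2 := by
    intro n w hw
    have h := (norm_eq_iInf_iff_real_inner_le_zero (hconv n) (hxC n)).1 (hx n) w hw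
    have e : ‖w‖ ^ 2 = ‖w - x n‖ ^ 2 + 2 * inner ℝ (w - x n) (x n) + ‖x n‖ ^ 2 := by
      rw [← norm_add_sq_real, sub_add_cancel]
    rw [zero_sub, inner_neg_left, real_inner_comm] at h
    linarith
  have hmono : Monotone fun n => ‖x n‖ ^ 2 := fun n m hnm => by
    have := hinner n (x m) (hanti hnm (hxC m))
    have := sq_nonneg ‖x m - x n‖
    dsimp only
    linarith
  obtain ⟨R, hR⟩ := hbdd.exists_norm_le
  have hlim := tendsto_atTop_ciSup hmono ⟨R ^ 2, by
    rintro _ ⟨n, rfl⟩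
    exact pow_le_pow_left₀ (norm_nonneg _) (hR _ (hanti (Nat.zero_le n) (hxC n))) 2⟩
  have hcau : CauchySeq x := by
    rw [Metric.cauchySeq_iff']
    intro ε hε
    obtain ⟨N, hN⟩ := Metric.cauchySeq_iff'.1 hlim.cauchySeq (ε ^ 2) (by positivity)
    refine ⟨N, fun n hn => ?_⟩
    have h1 := hinner N (x n) (hanti hn (hxC n))
    have h2 := hN n hn
    rw [Real.dist_eq] at h2
    rw [dist_eq_norm]
    exact lt_of_pow_lt_pow_left₀ 2 hε.le (h1.trans_lt ((le_abs_self _).trans_lt h2))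
  obtain ⟨y, hy⟩ := cauchySeq_tendsto_of_complete hcau
  refine ⟨y, Set.mem_iInter.2 fun n => (hclosed n).mem_of_tendsto hy ?_⟩
  filter_upwards [Filter.eventually_ge_atTop n] with m hm using hanti hm (hxC m)

theorem IsClosed.image_of_convex_of_isBounded {E F : Type*} [NormedAddCommGroup E]
    [InnerProductSpace ℝ E] [CompleteSpace E] [NormedAddCommGroup F] [NormedSpace ℝ F]
    {s : Set E} (hclosed : IsClosed s) (hconv : Convex ℝ s) (hbdd : Bornology.IsBounded s)
    (A : E →L[ℝ] F) : IsClosed (A '' s) := by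
  refine isClosed_of_closure_subset fun y hy => ?_
  obtain ⟨x, hx⟩ := nonempty_iInter_of_antitone_of_convex
    (C := fun n : ℕ => s ∩ A ⁻¹' Metric.closedBall y (1 / (n + 1)))
    (fun n m hnm => Set.inter_subset_inter_right _ <| Set.preimage_mono <|
      Metric.closedBall_subset_closedBall <| one_div_le_one_div_of_le (by positivity) (by
        have : (n : ℝ) ≤ m := by exact_mod_cast hnm
        linarith))
    (fun n => by
      obtain ⟨_, ⟨x, hx, rfl⟩, h⟩ := Metric.mem_closure_iff.1 hy (1 / (n + 1)) (by positivity)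
      exact ⟨x, hx, by
        rw [Set.mem_preimage, Metric.mem_closedBall, dist_comm]
        exact h.le⟩)
    (fun n => hclosed.inter (Metric.isClosed_closedBall.preimage A.continuous))
    (fun n => hconv.inter ((convex_closedBall y _).linear_preimage A.toLinearMap))
    (hbdd.subset Set.inter_subset_left)
  rw [Set.mem_iInter] at hx
  refine ⟨x, (hx 0).1, dist_le_zero.1 <| ge_of_tendsto' tendsto_one_div_add_atTop_nhds_zero_nat
    fun n => (hx n).2⟩

theorem exists_mem_forall_inner_eq {E F : Type*} [NormedAddCommGroup E] [InnerProductSpace ℝ E]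
    [CompleteSpace E] [NormedAddCommGroup F] [InnerProductSpace ℝ F] [CompleteSpace F]
    {s : Set E} (hclosed : IsClosed s) (hconv : Convex ℝ s) (hbdd : Bornology.IsBounded s)
    (T : F →L[ℝ] E) (q : F) (h : ∀ w, ∃ f ∈ s, inner ℝ w q ≤ inner ℝ (T w) f) :
    ∃ f ∈ s, ∀ w, inner ℝ w q = inner ℝ (T w) f := by
  set A := ContinuousLinearMap.adjoint T
  have hA : Convex ℝ (A '' s) := hconv.linear_image A.toLinearMap
  have hne : (A '' s).Nonempty := Set.Nonempty.image A ((h 0).imp fun _ hx => hx.1)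
  obtain ⟨p, hpA, hp⟩ := exists_norm_eq_iInf_of_complete_convex hne
    (hclosed.image_of_convex_of_isBounded hconv hbdd A).isComplete hA q
  have hle := (norm_eq_iInf_iff_real_inner_le_zero hA hpA).1 hp
  obtain ⟨g, hg, hqg⟩ := h (q - p)
  have hqp : q - p = 0 := by
    have h1 := hle _ (Set.mem_image_of_mem A hg)
    rw [inner_sub_right, ContinuousLinearMap.adjoint_inner_right] at h1
    rw [← inner_self_eq_zero (𝕜 := ℝ)]
    refine le_antisymm ?_ real_inner_self_nonneg
    rw [inner_sub_right]
    linarith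
  obtain ⟨f, hf, hfp⟩ := hpA
  refine ⟨f, hf, fun w => ?_⟩
  rw [← ContinuousLinearMap.adjoint_inner_right, sub_eq_zero.1 hqp, ← hfp]

theorem isClosed_convex_isBounded_Lp_two_unit {α : Type*} [MeasurableSpace α] (μ : Measure α)
    [IsProbabilityMeasure μ] :
    let s : Set (Lp ℝ 2 μ) := {f | ∀ᵐ x ∂μ, f x ∈ Set.Icc (0 : ℝ) 1}
    IsClosed s ∧ Convex ℝ s ∧ Bornology.IsBounded s := by
  intro s
  refine ⟨?_, ?_, ?_⟩
  · have : s = Set.Icc 0 (Lp.const 2 μ (1 : ℝ)) := by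
      ext f
      simp only [s, Set.mem_ofPred_eq, Set.mem_Icc, ← Lp.coeFn_le, Filter.eventually_and]
      refine and_congr ?_ ?_
      · refine Filter.eventually_congr ?_
        filter_upwards [Lp.coeFn_zero ℝ 2 μ] with x hx
        rw [hx, Pi.zero_apply]
      · refine Filter.eventually_congr ?_
        filter_upwards [Lp.coeFn_const (p := 2) (μ := μ) (1 : ℝ)] with x hx
        rw [hx, Function.const_apply]
    rw [this]
    exact isClosed_Icc
  · intro f hf g hg a b ha hb hab
    filter_upwards [hf, hg, Lp.coeFn_add (a • f) (b • g), Lp.coeFn_smul a f, Lp.coeFn_smul b g]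
      with x h1 h2 h3 h4 h5
    rw [h3, Pi.add_apply, h4, h5]
    exact convex_Icc 0 1 h1 h2 ha hb hab
  · refine (Metric.isBounded_closedBall (x := (0 : Lp ℝ 2 μ)) (r := 1)).subset fun f hf => ?_
    have := Lp.norm_le_of_ae_bound (f := f) (C := 1) zero_le_one (by
      filter_upwards [hf] with x hx
      rw [Real.norm_eq_abs, abs_le]
      exact ⟨by linarith [hx.1], hx.2⟩)
    simpa [measureUnivNNReal] using this

theorem exists_marginals_of_forall_integral_le {α β : Type*} [MeasurableSpace α]
    [MeasurableSpace β] (μ : Measure α) (ν : Measure β) [IsProbabilityMeasure μ]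
    [IsProbabilityMeasure ν] {a : α → ℝ} {b : β → ℝ} (ha : MemLp a 2 μ) (hb : MemLp b 2 ν)
    (h : ∀ (u : α → ℝ) (v : β → ℝ), Measurable u → Measurable v → MemLp u 2 μ → MemLp v 2 ν →
      ∫ x, u x * a x ∂μ + ∫ y, v y * b y ∂ν ≤ ∫ z, max (u z.1 + v z.2) 0 ∂μ.prod ν) :
    ∃ f : α × β → ℝ, Measurable f ∧ (∀ z, f z ∈ Set.Icc (0 : ℝ) 1) ∧
      (∀ᵐ x ∂μ, a x = ∫ y, f (x, y) ∂ν) ∧ ∀ᵐ y ∂ν, b y = ∫ x, f (x, y) ∂μ := by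
  obtain ⟨hclosed, hconv, hbdd⟩ := isClosed_convex_isBounded_Lp_two_unit (μ.prod ν)
  set s : Set (Lp ℝ 2 (μ.prod ν)) := {f | ∀ᵐ x ∂μ.prod ν, f x ∈ Set.Icc (0 : ℝ) 1}
  have hfst : MeasurePreserving Prod.fst (μ.prod ν) μ := measurePreserving_fst
  have hsnd : MeasurePreserving Prod.snd (μ.prod ν) ν := measurePreserving_snd
  let T : WithLp 2 (Lp ℝ 2 μ × Lp ℝ 2 ν) →L[ℝ] Lp ℝ 2 (μ.prod ν) :=
    ((Lp.compMeasurePreservingₗᵢ ℝ Prod.fst hfst).toContinuousLinearMap.coprod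
      (Lp.compMeasurePreservingₗᵢ ℝ Prod.snd hsnd).toContinuousLinearMap).comp
      (WithLp.prodContinuousLinearEquiv 2 ℝ (Lp ℝ 2 μ) (Lp ℝ 2 ν)).toContinuousLinearMap
  have hT : ∀ w, T w =ᵐ[μ.prod ν] fun z => w.fst z.1 + w.snd z.2 := fun w => by
    have e : T w = Lp.compMeasurePreserving Prod.fst hfst w.fst +
      Lp.compMeasurePreserving Prod.snd hsnd w.snd := rfl
    rw [e]
    filter_upwards [Lp.coeFn_add (Lp.compMeasurePreserving Prod.fst hfst w.fst)
      (Lp.compMeasurePreserving Prod.snd hsnd w.snd), Lp.coeFn_compMeasurePreserving w.fst hfst,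
      Lp.coeFn_compMeasurePreserving w.snd hsnd] with z h1 h2 h3
    rw [h1, Pi.add_apply, h2, h3]
    rfl
  have hq : ∀ w : WithLp 2 (Lp ℝ 2 μ × Lp ℝ 2 ν),
      inner ℝ w (WithLp.toLp 2 (ha.toLp a, hb.toLp b)) =
        ∫ x, w.fst x * a x ∂μ + ∫ y, w.snd y * b y ∂ν := fun w => by
    rw [WithLp.prod_inner_apply, L2.inner_def, L2.inner_def]
    congr 1
    · refine integral_congr_ae ?_
      filter_upwards [ha.coeFn_toLp] with x hx
      simp [hx, mul_comm]
    · refine integral_congr_ae ?_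
      filter_upwards [hb.coeFn_toLp] with x hx
      simp [hx, mul_comm]
  have hTf : ∀ w (f : Lp ℝ 2 (μ.prod ν)),
      inner ℝ (T w) f = ∫ z, (w.fst z.1 + w.snd z.2) * f z ∂μ.prod ν := fun w f => by
    rw [L2.inner_def]
    refine integral_congr_ae ?_
    filter_upwards [hT w] with z hz
    simp [hz, mul_comm]
  obtain ⟨f, hf, hfw⟩ := exists_mem_forall_inner_eq hclosed hconv hbdd T
    (WithLp.toLp 2 (ha.toLp a, hb.toLp b)) fun w => by
      have hu := (Lp.stronglyMeasurable w.fst).measurable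
      have hv := (Lp.stronglyMeasurable w.snd).measurable
      have hS : MeasurableSet {z : α × β | 0 < w.fst z.1 + w.snd z.2} :=
        measurableSet_lt measurable_const ((hu.comp measurable_fst).add (hv.comp measurable_snd))
      refine ⟨indicatorConstLp 2 hS (measure_ne_top _ _) (1 : ℝ), ?_, ?_⟩
      · change ∀ᵐ _ ∂_, _
        filter_upwards [indicatorConstLp_coeFn (p := 2) (hs := hS)
          (hμs := measure_ne_top (μ.prod ν) _) (c := (1 : ℝ))] with z hz
        rw [hz]
        by_cases hz' : z ∈ {z : α × β | 0 < w.fst z.1 + w.snd z.2} <;> simp [hz']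
      · rw [hq, hTf]
        refine (h _ _ hu hv (Lp.memLp _) (Lp.memLp _)).trans_eq (integral_congr_ae ?_)
        filter_upwards [indicatorConstLp_coeFn (p := 2) (hs := hS)
          (hμs := measure_ne_top (μ.prod ν) _) (c := (1 : ℝ))] with z hz
        rw [hz]
        by_cases hz' : 0 < w.fst z.1 + w.snd z.2
        · simp [hz', hz'.le]
        · simp [hz', not_lt.1 hz']
  set g : α × β → ℝ := fun z => max 0 (min (f z) 1) with hg
  have hgm : Measurable g :=
    measurable_const.max ((Lp.stronglyMeasurable f).measurable.min measurable_const)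
  have hg01 : ∀ z, g z ∈ Set.Icc (0 : ℝ) 1 := fun z =>
    ⟨le_max_left _ _, max_le zero_le_one (min_le_right _ _)⟩
  have hgf : g =ᵐ[μ.prod ν] f := by
    filter_upwards [hf] with z hz
    simp [hg, hz.1, hz.2]
  have hgi : Integrable g (μ.prod ν) := Integrable.of_bound hgm.aestronglyMeasurable 1
    (.of_forall fun z => by rw [Real.norm_eq_abs, abs_of_nonneg (hg01 z).1]; exact (hg01 z).2)
  have key : ∀ u v, MemLp u 2 μ → MemLp v 2 ν →
      ∫ x, u x * a x ∂μ + ∫ y, v y * b y ∂ν = ∫ z, (u z.1 + v z.2) * g z ∂μ.prod ν := by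
    intro u v hu hv
    have h0 := hfw (WithLp.toLp 2 (hu.toLp u, hv.toLp v))
    rw [hTf, hq] at h0
    convert h0 using 1
    · congr 1
      · refine integral_congr_ae ?_
        filter_upwards [hu.coeFn_toLp] with x hx
        simp [hx]
      · refine integral_congr_ae ?_
        filter_upwards [hv.coeFn_toLp] with x hx
        simp [hx]
    · refine integral_congr_ae ?_
      filter_upwards [hgf, hfst.quasiMeasurePreserving.ae hu.coeFn_toLp,
        hsnd.quasiMeasurePreserving.ae hv.coeFn_toLp] with z h1 h2 h3
      simp [h1, h2, h3]
  refine ⟨g, hgm, hg01, ?_, ?_⟩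
  · refine (ha.integrable one_le_two).ae_eq_of_forall_setIntegral_eq _ _ hgi.integral_prod_left
      fun S hS _ => ?_
    have h0 := key (S.indicator 1) 0 ((memLp_const 1).indicator hS) MemLp.zero
    rw [← integral_indicator hS, ← integral_indicator hS]
    simp only [Pi.zero_apply, zero_mul, integral_zero, add_zero] at h0
    have hi : Integrable (fun z : α × β => S.indicator 1 z.1 * g z) (μ.prod ν) := by
      refine (hgi.indicator (measurable_fst hS)).congr (.of_forall fun z => ?_)
      by_cases hz : z.1 ∈ S <;> simp [hz]
    rw [integral_prod _ hi] at h0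
    simp only [integral_const_mul] at h0
    convert h0 using 3 with x x <;> by_cases hx : x ∈ S <;> simp [hx]
  · refine (hb.integrable one_le_two).ae_eq_of_forall_setIntegral_eq _ _ hgi.integral_prod_right
      fun S hS _ => ?_
    have h0 := key 0 (S.indicator 1) MemLp.zero ((memLp_const 1).indicator hS)
    rw [← integral_indicator hS, ← integral_indicator hS]
    simp only [Pi.zero_apply, zero_mul, integral_zero, zero_add] at h0
    have hi : Integrable (fun z : α × β => S.indicator 1 z.2 * g z) (μ.prod ν) := by
      refine (hgi.indicator (measurable_snd hS)).congr (.of_forall fun z => ?_)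
      by_cases hz : z.2 ∈ S <;> simp [hz]
    rw [integral_prod_symm _ hi] at h0
    simp only [integral_const_mul] at h0
    convert h0 using 3 with x x <;> by_cases hx : x ∈ S <;> simp [hx]

theorem integral_setIntegral_slice {γ : Type*} [MeasurableSpace γ] (μ : Measure γ) [SFinite μ]
    (I : Measure ℝ) [IsFiniteMeasure I] {w : γ → ℝ} (hw : Integrable w μ) {R : Set (ℝ × γ)}
    (hR : MeasurableSet R) :
    Integrable (fun s => ∫ x in {x | (s, x) ∈ R}, w x ∂μ) I ∧
      ∫ s, ∫ x in {x | (s, x) ∈ R}, w x ∂μ ∂I = ∫ x, w x * I.real {s | (s, x) ∈ R} ∂μ := by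
  have hi : Integrable (R.indicator fun p => w p.2) (I.prod μ) := (hw.comp_snd I).indicator hR
  have e : ∀ s, ∫ x in {x | (s, x) ∈ R}, w x ∂μ = ∫ x, R.indicator (fun p => w p.2) (s, x) ∂μ :=
    fun s => by
      rw [← integral_indicator (show MeasurableSet {x | (s, x) ∈ R} from measurable_prodMk_left hR)]
      rfl
  simp only [e]
  refine ⟨hi.integral_prod_left, ?_⟩
  rw [← integral_prod _ hi, integral_prod_symm _ hi]
  refine integral_congr_ae (.of_forall fun x => ?_)
  have : (fun s => R.indicator (fun p => w p.2) (s, x)) =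
      {s | (s, x) ∈ R}.indicator fun _ => w x := rfl
  dsimp only
  rw [this, integral_indicator_const _
    (show MeasurableSet {s | (s, x) ∈ R} from measurable_prodMk_right hR), smul_eq_mul, mul_comm]

theorem integral_add_integral_le_of_bounded {α β : Type*} [MeasurableSpace α]
    [MeasurableSpace β] (μ : Measure α) (ν : Measure β) [IsProbabilityMeasure μ]
    [IsProbabilityMeasure ν] {a : α → ℝ} {b : β → ℝ} (ha : Integrable a μ) (hb : Integrable b ν)
    (hab : ∫ x, a x ∂μ = ∫ y, b y ∂ν)
    (h : ∀ A B, MeasurableSet A → MeasurableSet B →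
      ∫ x in A, a x ∂μ ≤ ∫ y in Bᶜ, b y ∂ν + μ.real A * ν.real B)
    {u : α → ℝ} {v : β → ℝ} (hu : Measurable u) (hv : Measurable v) {M : ℝ}
    (huM : ∀ x, |u x| ≤ M) (hvM : ∀ y, |v y| ≤ M) :
    ∫ x, u x * a x ∂μ + ∫ y, v y * b y ∂ν ≤ ∫ z, max (u z.1 + v z.2) 0 ∂μ.prod ν := by
  have hvol : ∀ S : Set ℝ, MeasurableSet S → (volume.restrict (Set.Ico (-M) M)).real S =
      volume.real (S ∩ Set.Ico (-M) M) := fun S hS => measureReal_restrict_apply hS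
  have hIio : ∀ c, |c| ≤ M → (volume.restrict (Set.Ico (-M) M)).real (Set.Iio c) = c + M := by
    intro c hc
    rw [abs_le] at hc
    rw [hvol _ measurableSet_Iio, Set.inter_comm, Set.Ico_inter_Iio, min_eq_right hc.2,
      Real.volume_real_Ico_of_le hc.1]
    ring
  have hIco : ∀ c d, |c| ≤ M → |d| ≤ M →
      (volume.restrict (Set.Ico (-M) M)).real (Set.Ico (-d) c) = max (c + d) 0 := by
    intro c d hc hd
    rw [abs_le] at hc hd
    rw [hvol _ measurableSet_Ico, Set.Ico_inter_Ico, min_eq_left hc.2,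
      max_eq_left (by linarith), Real.volume_real_Ico, sub_neg_eq_add]
  have hR₁ : MeasurableSet {p : ℝ × α | p.1 < u p.2} :=
    measurableSet_lt measurable_fst (hu.comp measurable_snd)
  have hR₂ : MeasurableSet {p : ℝ × β | p.1 < -v p.2} :=
    measurableSet_lt measurable_fst (hv.comp measurable_snd).neg
  have hR₃ : MeasurableSet {p : ℝ × (α × β) | p.1 < u p.2.1 ∧ -v p.2.2 ≤ p.1} :=
    (measurableSet_lt measurable_fst (hu.comp (measurable_fst.comp measurable_snd))).inter
      (measurableSet_le (hv.comp (measurable_snd.comp measurable_snd)).neg measurable_fst)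
  obtain ⟨i₁, e₁⟩ := integral_setIntegral_slice μ (volume.restrict (Set.Ico (-M) M)) ha hR₁
  obtain ⟨i₂, e₂⟩ := integral_setIntegral_slice ν (volume.restrict (Set.Ico (-M) M)) hb hR₂
  obtain ⟨i₃, e₃⟩ := integral_setIntegral_slice (μ.prod ν) (volume.restrict (Set.Ico (-M) M))
    (integrable_const (1 : ℝ)) hR₃
  have hle := integral_mono i₁ (i₂.add i₃) fun s => by
    have hs := h {x | s < u x} {y | -v y ≤ s} (measurableSet_lt measurable_const hu)
      (measurableSet_le hv.neg measurable_const)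
    have hc : {y | -v y ≤ s}ᶜ = {y | s < -v y} := by ext; simp
    have hp : (μ.prod ν).real {z : α × β | s < u z.1 ∧ -v z.2 ≤ s} =
      μ.real {x | s < u x} * ν.real {y | -v y ≤ s} := by
      rw [← measureReal_prod_prod]
      rfl
    rw [hc, ← hp] at hs
    simpa using hs
  rw [integral_add' i₂ i₃, e₁, e₂, e₃] at hle
  have c₁ : ∀ x, (volume.restrict (Set.Ico (-M) M)).real {s | (s, x) ∈ {p : ℝ × α | p.1 < u p.2}}
      = u x + M := fun x => hIio _ (huM x)
  have c₂ : ∀ y, (volume.restrict (Set.Ico (-M) M)).real {s | (s, y) ∈ {p : ℝ × β | p.1 < -v p.2}}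
      = -v y + M := fun y =>
    hIio (-v y) (by rw [abs_neg]; exact hvM y)
  have c₃ : ∀ z, (volume.restrict (Set.Ico (-M) M)).real
      {s | (s, z) ∈ {p : ℝ × (α × β) | p.1 < u p.2.1 ∧ -v p.2.2 ≤ p.1}}
      = max (u z.1 + v z.2) 0 := fun z => by
    rw [← hIco _ _ (huM _) (hvM _)]
    congr 1
    ext s
    exact and_comm
  simp only [c₁, c₂, c₃, one_mul] at hle
  have hua : Integrable (fun x => u x * a x) μ :=
    ha.bdd_mul hu.aestronglyMeasurable (.of_forall huM)
  have hvb : Integrable (fun y => v y * b y) ν :=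
    hb.bdd_mul hv.aestronglyMeasurable (.of_forall hvM)
  have d₁ : ∫ x, a x * (u x + M) ∂μ = ∫ x, u x * a x ∂μ + M * ∫ x, a x ∂μ := by
    rw [← integral_const_mul, ← integral_add hua (ha.const_mul M)]
    exact integral_congr_ae (.of_forall fun x => by ring)
  have d₂ : ∫ y, b y * (-v y + M) ∂ν = M * ∫ y, b y ∂ν - ∫ y, v y * b y ∂ν := by
    rw [← integral_const_mul, ← integral_sub (hb.const_mul M) hvb]
    exact integral_congr_ae (.of_forall fun x => by ring)
  rw [d₁, d₂, hab] at hle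
  linarith

theorem integral_add_integral_le_integral_max {α β : Type*} [MeasurableSpace α]
    [MeasurableSpace β] (μ : Measure α) (ν : Measure β) [IsProbabilityMeasure μ]
    [IsProbabilityMeasure ν] {a : α → ℝ} {b : β → ℝ} (ha : MemLp a 2 μ) (hb : MemLp b 2 ν)
    (hab : ∫ x, a x ∂μ = ∫ y, b y ∂ν)
    (h : ∀ A B, MeasurableSet A → MeasurableSet B →
      ∫ x in A, a x ∂μ ≤ ∫ y in Bᶜ, b y ∂ν + μ.real A * ν.real B)
    {u : α → ℝ} {v : β → ℝ} (hu : Measurable u) (hv : Measurable v) (hu₂ : MemLp u 2 μ)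
    (hv₂ : MemLp v 2 ν) :
    ∫ x, u x * a x ∂μ + ∫ y, v y * b y ∂ν ≤ ∫ z, max (u z.1 + v z.2) 0 ∂μ.prod ν := by
  set tr : ℕ → ℝ → ℝ := fun n x => max (-n) (min x n) with htr
  have htrm : ∀ n, Measurable (tr n) := fun n => by fun_prop
  have htr_abs : ∀ n x, |tr n x| ≤ |x| := fun n x => by
    have hn : (0 : ℝ) ≤ n := n.cast_nonneg
    rw [abs_le]
    refine ⟨le_max_of_le_right (le_min (neg_abs_le x) (by linarith [abs_nonneg x])),
      max_le (by linarith [abs_nonneg x]) (min_le_of_left_le (le_abs_self x))⟩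
  have htr_le : ∀ n x, |tr n x| ≤ n := fun n x => by
    have hn : (0 : ℝ) ≤ n := n.cast_nonneg
    rw [abs_le]
    exact ⟨le_max_left _ _, max_le (by linarith) (min_le_right _ _)⟩
  have htr_lim : ∀ x, Filter.Tendsto (fun n => tr n x) Filter.atTop (nhds x) := fun x => by
    refine tendsto_const_nhds.congr' ?_
    filter_upwards [Filter.eventually_ge_atTop ⌈|x|⌉₊] with n hn
    have := abs_le.1 (Nat.ceil_le.1 hn)
    rw [htr]
    dsimp only
    rw [min_eq_left this.2, max_eq_right this.1]
  have l₁ : Filter.Tendsto (fun n => ∫ x, tr n (u x) * a x ∂μ) Filter.atTop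
      (nhds (∫ x, u x * a x ∂μ)) := by
    refine tendsto_integral_of_dominated_convergence (fun x => |u x * a x|)
      (fun n => ((htrm n).comp hu).aestronglyMeasurable.mul ha.1) (hu₂.integrable_mul ha).abs
      (fun n => .of_forall fun x => ?_) (.of_forall fun x => (htr_lim _).mul_const _)
    rw [Real.norm_eq_abs, abs_mul, abs_mul]
    exact mul_le_mul_of_nonneg_right (htr_abs _ _) (abs_nonneg _)
  have l₂ : Filter.Tendsto (fun n => ∫ y, tr n (v y) * b y ∂ν) Filter.atTop
      (nhds (∫ y, v y * b y ∂ν)) := by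
    refine tendsto_integral_of_dominated_convergence (fun x => |v x * b x|)
      (fun n => ((htrm n).comp hv).aestronglyMeasurable.mul hb.1) (hv₂.integrable_mul hb).abs
      (fun n => .of_forall fun x => ?_) (.of_forall fun x => (htr_lim _).mul_const _)
    rw [Real.norm_eq_abs, abs_mul, abs_mul]
    exact mul_le_mul_of_nonneg_right (htr_abs _ _) (abs_nonneg _)
  have l₃ : Filter.Tendsto (fun n => ∫ z, max (tr n (u z.1) + tr n (v z.2)) 0 ∂μ.prod ν)
      Filter.atTop (nhds (∫ z, max (u z.1 + v z.2) 0 ∂μ.prod ν)) := by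
    refine tendsto_integral_of_dominated_convergence (fun z => |u z.1| + |v z.2|)
      (fun n => Measurable.aestronglyMeasurable (by fun_prop))
      (((hu₂.integrable one_le_two).abs.comp_fst ν).add
        ((hv₂.integrable one_le_two).abs.comp_snd μ))
      (fun n => .of_forall fun z => ?_)
      (.of_forall fun z => ((htr_lim _).add (htr_lim _)).max tendsto_const_nhds)
    rw [Real.norm_eq_abs, abs_of_nonneg (le_max_right _ _)]
    refine max_le (add_le_add ((le_abs_self _).trans (htr_abs _ _))
      ((le_abs_self _).trans (htr_abs _ _))) (by positivity)
  exact le_of_tendsto_of_tendsto' (l₁.add l₂) l₃ fun n =>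
    integral_add_integral_le_of_bounded μ ν (ha.integrable one_le_two) (hb.integrable one_le_two)
      hab h ((htrm n).comp hu) ((htrm n).comp hv) (fun _ => htr_le _ _) fun _ => htr_le _ _

theorem MonoLC.exists_monotone {q : ℝ → ℝ} (hq : MonoLC q) :
    ∃ q' : ℝ → ℝ, Monotone q' ∧ (∀ t, q' t ∈ Set.Icc (0 : ℝ) 1) ∧
      Set.EqOn q q' (Set.Icc 0 1) := by
  have hmem : ∀ t : ℝ, max 0 (min t 1) ∈ Set.Icc (0 : ℝ) 1 := fun t =>
    ⟨le_max_left _ _, max_le zero_le_one (min_le_right _ _)⟩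
  refine ⟨fun t => q (max 0 (min t 1)), fun s t hst => hq.1 (hmem s) (hmem t) ?_,
    fun t => hq.2.1 _ (hmem t), fun t ht => ?_⟩
  · exact max_le_max le_rfl (min_le_min hst le_rfl)
  · dsimp only
    rw [min_eq_left ht.2, max_eq_right ht.1]

theorem conj_congr {g g' : ℝ → ℝ} (h : Set.EqOn g g' (Set.Icc 0 1)) : conj g = conj g' := by
  funext z
  have : {x | x ∈ Set.Icc (0 : ℝ) 1 ∧ 1 - z < g x} =
      {x | x ∈ Set.Icc (0 : ℝ) 1 ∧ 1 - z < g' x} := by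
    ext x
    exact and_congr_right fun hx => by rw [h hx]
  rw [conj, conj, ginv, ginv, this]

theorem conj_eq_measureReal {q : ℝ → ℝ} (hq : Monotone q) (z : ℝ) :
    conj q z = (volume.restrict (Set.Icc (0 : ℝ) 1)).real {y | 1 - z < q y} := by
  rw [measureReal_restrict_apply (measurableSet_lt measurable_const hq.measurable), conj, ginv]
  set S : Set ℝ := insert 1 {x | x ∈ Set.Icc (0 : ℝ) 1 ∧ 1 - z < q x} with hS
  have hS0 : ∀ x ∈ S, 0 ≤ x := by
    rintro x (rfl | hx)
    · exact zero_le_one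
    · exact hx.1.1
  have hbdd : BddBelow S := ⟨0, hS0⟩
  have hne : S.Nonempty := ⟨1, Set.mem_insert _ _⟩
  have h0 : 0 ≤ sInf S := le_csInf hne hS0
  have h1 : sInf S ≤ 1 := csInf_le hbdd (Set.mem_insert _ _)
  have hsub : {y | 1 - z < q y} ∩ Set.Icc 0 1 ⊆ Set.Icc (sInf S) 1 := fun y hy =>
    ⟨csInf_le hbdd (Set.mem_insert_of_mem _ ⟨hy.2, hy.1⟩), hy.2.2⟩
  have hsup : Set.Ioo (sInf S) 1 ⊆ {y | 1 - z < q y} ∩ Set.Icc 0 1 := fun y hy => by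
    obtain ⟨x, hx, hxy⟩ := exists_lt_of_csInf_lt hne hy.1
    rcases hx with rfl | hx
    · exact absurd hy.2 hxy.not_gt
    · exact ⟨lt_of_lt_of_le hx.2 (hq hxy.le), h0.trans hy.1.le, hy.2.le⟩
  refine le_antisymm ?_ ?_
  · rw [← Real.volume_real_Ioo_of_le h1]
    exact measureReal_mono hsup
      (measure_ne_top_of_subset hsub (by rw [Real.volume_Icc]; exact ENNReal.ofReal_ne_top))
  · rw [← Real.volume_real_Icc_of_le h1]
    exact measureReal_mono hsub (by rw [Real.volume_Icc]; exact ENNReal.ofReal_ne_top)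

theorem intervalIntegral_conj_eq {q : ℝ → ℝ} (hq : Monotone q)
    (h01 : ∀ t, q t ∈ Set.Icc (0 : ℝ) 1) {x : ℝ}
    (hx : x ∈ Set.Icc (0 : ℝ) 1) :
    ∫ z in x..1, conj q z = ∫ y in Set.Icc (0 : ℝ) 1, min (q y) (1 - x) := by
  have hR : MeasurableSet {p : ℝ × ℝ | 1 - p.1 < q p.2} :=
    measurableSet_lt (measurable_const.sub measurable_fst) (hq.measurable.comp measurable_snd)
  have h := (integral_setIntegral_slice (volume.restrict (Set.Icc (0 : ℝ) 1))
    (volume.restrict (Set.Ioc x 1)) (integrable_const (1 : ℝ)) hR).2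
  rw [intervalIntegral.integral_of_le hx.2]
  convert h using 1
  · refine integral_congr_ae (.of_forall fun z => ?_)
    simp [conj_eq_measureReal hq]
  · refine integral_congr_ae (.of_forall fun y => ?_)
    have e : {s | (s, y) ∈ {p : ℝ × ℝ | 1 - p.1 < q p.2}} = Set.Ioi (1 - q y) := by
      ext s
      exact sub_lt_comm (a := (1 : ℝ))
    dsimp only
    rw [e, one_mul, measureReal_restrict_apply measurableSet_Ioi, Set.inter_comm,
      Set.Ioc_inter_Ioi, Real.volume_real_Ioc, ← min_sub_sub_left, sub_sub_cancel, min_comm,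
      max_eq_left (le_min (by linarith [hx.2]) (h01 y).1)]

theorem Monotone.integrable_of_mem_Icc {q : ℝ → ℝ} (hq : Monotone q)
    (h01 : ∀ t, q t ∈ Set.Icc (0 : ℝ) 1) (μ : Measure ℝ) [IsFiniteMeasure μ] : Integrable q μ :=
  Integrable.of_bound hq.measurable.aestronglyMeasurable 1
    (.of_forall fun t => by rw [Real.norm_eq_abs, abs_of_nonneg (h01 t).1]; exact (h01 t).2)

theorem Monotone.setIntegral_le_intervalIntegral {q : ℝ → ℝ} (hq : Monotone q)
    (h01 : ∀ t, q t ∈ Set.Icc (0 : ℝ) 1) (A : Set ℝ) :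
    ∫ x in A, q x ∂volume.restrict (Set.Icc 0 1) ≤
      ∫ x in (1 - (volume.restrict (Set.Icc (0 : ℝ) 1)).real A)..1, q x := by
  set μ := volume.restrict (Set.Icc (0 : ℝ) 1) with hμ
  have : IsProbabilityMeasure μ := ⟨by simp [hμ]⟩
  set m := μ.real A
  have hm0 : 0 ≤ m := measureReal_nonneg
  have hm1 : m ≤ 1 := measureReal_le_one
  set c := q (1 - m)
  have hi : Integrable q μ := hq.integrable_of_mem_Icc h01 μ
  have hi' : Integrable (fun x => max (q x - c) 0) μ := (hi.sub (integrable_const c)).pos_part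
  have e₁ : ∫ x in A, q x ∂μ = (∫ x in A, (q x - c) ∂μ) + m * c := by
    rw [integral_sub hi.integrableOn integrableOn_const, setIntegral_const, smul_eq_mul]
    ring
  have e₂ : ∫ x in A, (q x - c) ∂μ ≤ ∫ x, max (q x - c) 0 ∂μ :=
    (integral_mono (hi.sub (integrable_const c)).integrableOn hi'.integrableOn
      fun x => le_max_left _ _).trans
      (setIntegral_le_integral hi' (.of_forall fun x => le_max_right _ _))
  have e₃ : ∫ x, max (q x - c) 0 ∂μ = ∫ x in Set.Ioc (1 - m) 1, (q x - c) := by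
    rw [← Set.inter_eq_left.2 (Set.Ioc_subset_Icc_self.trans
      (Set.Icc_subset_Icc_left (sub_nonneg.2 hm1))), ← Measure.restrict_restrict measurableSet_Ioc,
      ← integral_indicator measurableSet_Ioc]
    refine setIntegral_congr_fun measurableSet_Icc fun x hx => ?_
    by_cases h : 1 - m < x
    · have : x ∈ Set.Ioc (1 - m) 1 := ⟨h, hx.2⟩
      simp [this, c, hq h.le]
    · have : x ∉ Set.Ioc (1 - m) 1 := fun h' => h h'.1
      simp [this, c, hq (not_lt.1 h)]
  have e₄ : ∫ x in Set.Ioc (1 - m) 1, (q x - c) = (∫ x in Set.Ioc (1 - m) 1, q x) - m * c := by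
    rw [integral_sub (hq.integrable_of_mem_Icc h01 _) (integrable_const c), setIntegral_const,
      Real.volume_real_Ioc_of_le (by linarith), smul_eq_mul]
    ring
  rw [intervalIntegral.integral_of_le (by linarith)]
  linarith

theorem volume_restrict_unitSq : volume.restrict unitSq =
    (volume.restrict (Set.Icc (0 : ℝ) 1)).prod (volume.restrict (Set.Icc (0 : ℝ) 1)) := by
  rw [Measure.prod_restrict, Set.Icc_prod_Icc]
  rfl

theorem mem_unitSq {x y : ℝ} (hx : x ∈ Set.Icc (0 : ℝ) 1) (hy : y ∈ Set.Icc (0 : ℝ) 1) :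
    (x, y) ∈ unitSq :=
  ⟨⟨hx.1, hy.1⟩, hx.2, hy.2⟩

theorem maj_conj_of_rat2 {f : ℝ × ℝ → ℝ} {q₁ q₂ : ℝ → ℝ} (hq₂ : Monotone q₂)
    (h01 : ∀ t, q₂ t ∈ Set.Icc (0 : ℝ) 1) (hf : Rat2 f q₁ q₂) : Maj q₁ (conj q₂) := by
  obtain ⟨hfm, hf01, hf₁, hf₂⟩ := hf
  set μ := volume.restrict (Set.Icc (0 : ℝ) 1) with hμ
  have hfae : ∀ᵐ z ∂μ.prod μ, f z ∈ Set.Icc (0 : ℝ) 1 := by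
    rw [← volume_restrict_unitSq]
    exact (ae_restrict_iff' measurableSet_Icc).2 (.of_forall hf01)
  rw [volume_restrict_unitSq] at hfm
  have hfi : Integrable f (μ.prod μ) := Integrable.of_bound hfm.aestronglyMeasurable 1 <| by
    filter_upwards [hfae] with z hz
    rw [Real.norm_eq_abs, abs_of_nonneg hz.1]
    exact hz.2
  have hswap : ∀ x ∈ Set.Icc (0 : ℝ) 1, Integrable f ((volume.restrict (Set.Ioc x 1)).prod μ) ∧
      ∫ t in x..1, q₁ t = ∫ y, (∫ t in Set.Ioc x 1, f (t, y)) ∂μ := fun x hx => by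
    have hsub : Set.Ioc x 1 ⊆ Set.Icc 0 1 := fun t ht => ⟨hx.1.trans ht.1.le, ht.2⟩
    have hle := Measure.restrict_mono_set volume hsub
    have hi : Integrable f ((volume.restrict (Set.Ioc x 1)).prod μ) :=
      hfi.mono_measure (Measure.prod_mono hle le_rfl)
    refine ⟨hi, ?_⟩
    rw [intervalIntegral.integral_of_le hx.2,
      ← integral_integral_swap (f := fun t y => f (t, y)) hi]
    exact integral_congr_ae (ae_mono hle hf₁)
  refine ⟨fun x hx => ?_, ?_⟩
  · obtain ⟨hi, e⟩ := hswap x hx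
    rw [e, intervalIntegral_conj_eq hq₂ h01 hx]
    refine integral_mono_ae hi.integral_prod_right (((hq₂.integrable_of_mem_Icc h01 μ).inf
      (integrable_const (1 - x)))) ?_
    filter_upwards [hf₂, hfi.prod_left_ae, ae_restrict_mem measurableSet_Icc] with y hy hiy hyI
    have hsub : Set.Ioc x 1 ⊆ Set.Icc 0 1 := fun t ht => ⟨hx.1.trans ht.1.le, ht.2⟩
    refine le_min ?_ ?_
    · rw [hy]
      refine setIntegral_mono_set hiy ?_ hsub.eventuallyLE
      exact (ae_restrict_iff' measurableSet_Icc).2 (.of_forall fun t ht =>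
        (hf01 _ (mem_unitSq ht hyI)).1)
    · have := setIntegral_mono_on (μ := volume) (IntegrableOn.mono_set hiy hsub)
        (integrableOn_const (C := (1 : ℝ)) (by simp)) measurableSet_Ioc
        fun t ht => (hf01 _ (mem_unitSq (hsub ht) hyI)).2
      simpa [Real.volume_real_Ioc_of_le hx.2] using this
  · have h0 : (0 : ℝ) ∈ Set.Icc (0 : ℝ) 1 := ⟨le_rfl, zero_le_one⟩
    rw [(hswap 0 h0).2, intervalIntegral_conj_eq hq₂ h01 h0]
    refine integral_congr_ae ?_
    filter_upwards [hf₂] with y hy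
    rw [sub_zero, min_eq_left (h01 y).2, hy, integral_Icc_eq_integral_Ioc]

theorem exists_rat2_of_maj_conj {q₁ q₂ : ℝ → ℝ} (hq₁ : Monotone q₁) (hq₂ : Monotone q₂)
    (h₁ : ∀ t, q₁ t ∈ Set.Icc (0 : ℝ) 1) (h₂ : ∀ t, q₂ t ∈ Set.Icc (0 : ℝ) 1)
    (h : Maj q₁ (conj q₂)) : ∃ f, Rat2 f q₁ q₂ := by
  set μ := volume.restrict (Set.Icc (0 : ℝ) 1) with hμ
  have : IsProbabilityMeasure μ := ⟨by simp [hμ]⟩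
  have hmem : ∀ {q : ℝ → ℝ}, Monotone q → (∀ t, q t ∈ Set.Icc (0 : ℝ) 1) → MemLp q 2 μ :=
    fun hq h01 => MemLp.of_bound hq.measurable.aestronglyMeasurable 1
      (.of_forall fun t => by rw [Real.norm_eq_abs, abs_of_nonneg (h01 t).1]; exact (h01 t).2)
  have hi₂ := hq₂.integrable_of_mem_Icc h₂ μ
  have heq : ∫ x, q₁ x ∂μ = ∫ y, q₂ y ∂μ := by
    have := h.2
    rw [intervalIntegral_conj_eq hq₂ h₂ ⟨le_rfl, zero_le_one⟩,
      intervalIntegral.integral_of_le zero_le_one,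
      ← integral_Icc_eq_integral_Ioc] at this
    rw [this]
    refine integral_congr_ae (.of_forall fun y => ?_)
    dsimp only
    rw [sub_zero, min_eq_left (h₂ y).2]
  have hset : ∀ A B, MeasurableSet A → MeasurableSet B →
      ∫ x in A, q₁ x ∂μ ≤ ∫ y in Bᶜ, q₂ y ∂μ + μ.real A * μ.real B := by
    intro A B hA hB
    have hm1 : μ.real A ≤ 1 := measureReal_le_one
    have hm : 1 - μ.real A ∈ Set.Icc (0 : ℝ) 1 := ⟨sub_nonneg.2 hm1,
      sub_le_self _ measureReal_nonneg⟩
    refine (hq₁.setIntegral_le_intervalIntegral h₁ A).trans ((h.1 _ hm).trans ?_)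
    have hmin : Integrable (fun y => min (q₂ y) (μ.real A)) μ := hi₂.inf (integrable_const _)
    rw [intervalIntegral_conj_eq hq₂ h₂ hm, sub_sub_cancel, ← integral_add_compl hB hmin, add_comm]
    refine add_le_add (integral_mono hmin.integrableOn hi₂.integrableOn fun y => min_le_left _ _)
      ((integral_mono hmin.integrableOn (integrableOn_const (C := μ.real A))
        fun y => min_le_right _ _).trans_eq ?_)
    rw [setIntegral_const, smul_eq_mul, mul_comm]
  obtain ⟨f, hfm, hf01, hf₁, hf₂⟩ := exists_marginals_of_forall_integral_le μ μ
    (hmem hq₁ h₁) (hmem hq₂ h₂) fun u v hu hv hu₂ hv₂ =>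
      integral_add_integral_le_integral_max μ μ (hmem hq₁ h₁) (hmem hq₂ h₂) heq hset hu hv hu₂ hv₂
  exact ⟨f, hfm.aemeasurable, fun z _ => hf01 z, hf₁, hf₂⟩

theorem Rat2.congr {f : ℝ × ℝ → ℝ} {q₁ q₂ p₁ p₂ : ℝ → ℝ} (h₁ : Set.EqOn q₁ p₁ (Set.Icc 0 1))
    (h₂ : Set.EqOn q₂ p₂ (Set.Icc 0 1)) (hf : Rat2 f q₁ q₂) : Rat2 f p₁ p₂ := by
  refine ⟨hf.1, hf.2.1, ?_, ?_⟩
  · filter_upwards [hf.2.2.1, ae_restrict_mem measurableSet_Icc] with t ht htI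
    rw [← h₁ htI, ht]
  · filter_upwards [hf.2.2.2, ae_restrict_mem measurableSet_Icc] with t ht htI
    rw [← h₂ htI, ht]

theorem Maj.congr_left {g g' k : ℝ → ℝ} (h : Set.EqOn g g' (Set.Icc 0 1)) (hm : Maj g k) :
    Maj g' k := by
  have e : ∀ x ∈ Set.Icc (0 : ℝ) 1, ∫ z in x..1, g z = ∫ z in x..1, g' z := fun x hx =>
    intervalIntegral.integral_congr fun z hz => by
      rw [Set.uIcc_of_le hx.2] at hz
      exact h ⟨hx.1.trans hz.1, hz.2⟩
  exact ⟨fun x hx => e x hx ▸ hm.1 x hx, e 0 ⟨le_rfl, zero_le_one⟩ ▸ hm.2⟩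

/-- Gutmann et al.: a pair `(q₁, q₂)` of nondecreasing left-continuous
functions `[0,1] → [0,1]` is rationalizable iff `q₁` is majorized by the conjugate of `q₂`. -/
theorem stmt12 (q₁ q₂ : ℝ → ℝ) (h1 : MonoLC q₁) (h2 : MonoLC q₂) :
    (∃ f, Rat2 f q₁ q₂) ↔ Maj q₁ (conj q₂) := by
  obtain ⟨p₁, hp₁, hp₁I, he₁⟩ := h1.exists_monotone
  obtain ⟨p₂, hp₂, hp₂I, he₂⟩ := h2.exists_monotone
  rw [conj_congr he₂]
  constructor
  · rintro ⟨f, hf⟩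
    exact (maj_conj_of_rat2 hp₂ hp₂I (hf.congr he₁ he₂)).congr_left he₁.symm
  · intro h
    obtain ⟨f, hf⟩ := exists_rat2_of_maj_conj hp₁ hp₂ hp₁I hp₂I (h.congr_left he₁)
    exact ⟨f, hf.congr he₁.symm he₂.symm⟩
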